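/- Let q = 2^k, and let f(X) in F_q[X] be a polynomial of degree n ≥ 6 lying in F_q[X^2]. Let Δ be the set of all a in F_q such that g_a(X) := (f(X+a) + f(a))/X can be written as v(D_s(X, b)) for some polynomial v(X) in F_q[X], some integer s ≥ 5, and some nonzero b in F_q. If |Δ| > 3, then f(X) = ρ(X^6 applied to η(X)) for some degree-one polynomials ρ(X), η(X) in F_q[X], i.e., f = ρ ∘ X^6 ∘ η. -/

import Mathlib

open Polynomial

/-- `p = X ^ N + A X ^ (N - 2) + B X ^ (N - 4) + D X ^ (N - 6)` up to terms of degree less than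
`N - 6`, where monomials with negative exponents are ignored. -/
def HasTopForm {F : Type*} [Field F] (p : F[X]) (N : ℕ) (A B D : F) : Prop :=
  X ^ 6 * p - X ^ N * (X ^ 6 + C A * X ^ 4 + C B * X ^ 2 + C D) ∈ degreeLT F N

theorem mul_mem_degreeLT {F : Type*} [Field F] {p q : F[X]} {a b : ℕ}
    (hp : p ∈ degreeLT F a) (hq : q.natDegree ≤ b) : p * q ∈ degreeLT F (a + b) := by
  rw [mem_degreeLT] at *
  by_cases h : p = 0
  · subst h; simp
  by_cases h' : q = 0
  · subst h'; simp
  rw [degree_eq_natDegree h] at hp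
  rw [degree_eq_natDegree (mul_ne_zero h h'), natDegree_mul h h']
  norm_cast at *
  omega

theorem mem_degreeLT_of_X_pow_mul {F : Type*} [Field F] {p : F[X]} {a N : ℕ}
    (h : X ^ a * p ∈ degreeLT F (N + a)) : p ∈ degreeLT F N := by
  rw [mem_degreeLT] at *
  by_cases hp : p = 0
  · subst hp; simp
  rw [degree_eq_natDegree (mul_ne_zero (by simp) hp), natDegree_mul (by simp) hp,
    natDegree_X_pow] at h
  rw [degree_eq_natDegree hp]
  norm_cast at *
  omega

theorem natDegree_le_of_mem_degreeLT {F : Type*} [Field F] {p : F[X]} {a : ℕ}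
    (h : p ∈ degreeLT F a) : p.natDegree ≤ a := by
  rw [mem_degreeLT] at h
  exact natDegree_le_of_degree_le h.le

theorem HasTopForm.mul {F : Type*} [Field F] {p p' : F[X]} {N N' : ℕ} {A B D A' B' D' : F}
    (h : HasTopForm p N A B D) (h' : HasTopForm p' N' A' B' D') :
    HasTopForm (p * p') (N + N') (A + A') (B + A * A' + B') (D + B * A' + A * B' + D') := by
  unfold HasTopForm at *
  set U : F[X] := X ^ 6 + C A * X ^ 4 + C B * X ^ 2 + C D with hU
  set U' : F[X] := X ^ 6 + C A' * X ^ 4 + C B' * X ^ 2 + C D' with hU'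
  generalize hr : X ^ 6 * p - X ^ N * U = r at h
  generalize hr' : X ^ 6 * p' - X ^ N' * U' = r' at h'
  have hUd : U.natDegree ≤ 6 := by rw [hU]; compute_degree
  have hUd' : U'.natDegree ≤ 6 := by rw [hU']; compute_degree
  have key : X ^ 6 * (X ^ 6 * (p * p') - X ^ (N + N') * (X ^ 6 + C (A + A') * X ^ 4 +
        C (B + A * A' + B') * X ^ 2 + C (D + B * A' + A * B' + D'))) =
      X ^ (N + N') * (C (A * D' + B * B' + D * A') * X ^ 4 + C (B * D' + D * B') * X ^ 2 +
        C (D * D')) + r' * (X ^ N * U) + r * (X ^ N' * U') + r * r' := by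
    rw [← hr, ← hr', hU, hU']
    simp only [map_add, map_mul, pow_add]
    ring
  apply mem_degreeLT_of_X_pow_mul (a := 6)
  rw [key]
  refine Submodule.add_mem _ (Submodule.add_mem _ (Submodule.add_mem _ ?_ ?_) ?_) ?_
  · have : C (A * D' + B * B' + D * A') * X ^ 4 + C (B * D' + D * B') * X ^ 2 +
        C (D * D') ∈ degreeLT F 6 := by
      rw [mem_degreeLT]
      refine lt_of_le_of_lt (b := ((4 : ℕ) : WithBot ℕ)) ?_ (by norm_num)
      compute_degree
      all_goals norm_num
    have := mul_mem_degreeLT this (natDegree_X_pow_le (R := F) (N + N'))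
    rwa [mul_comm, add_comm (N + N')]
  · have := mul_mem_degreeLT h' (natDegree_mul_le_of_le (natDegree_X_pow_le (R := F) N) hUd)
    rwa [show N' + (N + 6) = N + N' + 6 by ring] at this
  · have := mul_mem_degreeLT h (natDegree_mul_le_of_le (natDegree_X_pow_le (R := F) N') hUd')
    rwa [← add_assoc] at this
  · exact degreeLT_mono (by omega) (mul_mem_degreeLT h (natDegree_le_of_mem_degreeLT h'))

theorem HasTopForm.coeff {F : Type*} [Field F] {p : F[X]} {N : ℕ} {A B D : F}
    (h : HasTopForm p N A B D) {i j : ℕ} (hij : i + 6 = j + N) :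
    p.coeff i = (X ^ 6 + C A * X ^ 4 + C B * X ^ 2 + C D : F[X]).coeff j := by
  unfold HasTopForm at h
  rw [mem_degreeLT, degree_lt_iff_coeff_zero] at h
  have := h (i + 6) (by omega)
  rw [coeff_sub, sub_eq_zero, coeff_X_pow_mul, hij, coeff_X_pow_mul] at this
  exact this

theorem HasTopForm.natDegree_eq {F : Type*} [Field F] {p : F[X]} {N : ℕ} {A B D : F}
    (h : HasTopForm p N A B D) : p.natDegree = N := by
  apply natDegree_eq_of_le_of_coeff_ne_zero
  · rw [natDegree_le_iff_coeff_eq_zero]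
    intro i hi
    rw [h.coeff (j := i + 6 - N) (by omega)]
    apply coeff_eq_zero_of_natDegree_lt
    refine lt_of_le_of_lt (b := 6) ?_ (by omega)
    compute_degree
  · rw [h.coeff (j := 6) (by omega)]
    simp [coeff_X_pow]

theorem HasTopForm.one {F : Type*} [Field F] : HasTopForm (1 : F[X]) 0 0 0 0 := by
  simp [HasTopForm]

theorem HasTopForm.dickson_step {F : Type*} [Field F] {b : F} {s : ℕ} {A B D A' B' D' : F}
    (h : HasTopForm (dickson 1 b s) s A B D)
    (h' : HasTopForm (dickson 1 b (s + 1)) (s + 1) A' B' D') :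
    HasTopForm (dickson 1 b (s + 2)) (s + 2) (A' - b) (B' - b * A) (D' - b * B) := by
  unfold HasTopForm at *
  have e : X ^ 6 * dickson 1 b (s + 2) - X ^ (s + 2) *
      (X ^ 6 + C (A' - b) * X ^ 4 + C (B' - b * A) * X ^ 2 + C (D' - b * B)) =
      (X ^ 6 * dickson 1 b (s + 1) - X ^ (s + 1) *
        (X ^ 6 + C A' * X ^ 4 + C B' * X ^ 2 + C D')) * X -
      (X ^ 6 * dickson 1 b s - X ^ s * (X ^ 6 + C A * X ^ 4 + C B * X ^ 2 + C D)) * C b -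
      C (b * D) * X ^ s := by
    rw [dickson_add_two]
    simp only [map_sub, map_mul, pow_add]
    ring
  rw [e]
  refine Submodule.sub_mem _ (Submodule.sub_mem _ ?_ ?_) ?_
  · have := mul_mem_degreeLT h' (natDegree_X_le (R := F))
    exact this
  · exact degreeLT_mono (by omega) (mul_mem_degreeLT h (natDegree_C b).le)
  · rw [mem_degreeLT]
    exact (degree_C_mul_X_pow_le _ _).trans_lt (by norm_cast; omega)

section CharTwo

variable {F : Type*} [Field F] [CharP F 2]

theorem dickson_hasTopForm_four_mul (b : F) (k : ℕ) :
    HasTopForm (dickson 1 b (4 * k + 4)) (4 * k + 4) 0 0 0 ∧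
    HasTopForm (dickson 1 b (4 * k + 5)) (4 * k + 5) b (b ^ 2) 0 ∧
    HasTopForm (dickson 1 b (4 * k + 6)) (4 * k + 6) 0 (b ^ 2) 0 ∧
    HasTopForm (dickson 1 b (4 * k + 7)) (4 * k + 7) b 0 (b ^ 3) := by
  have two : (2 : F) = 0 := CharTwo.two_eq_zero
  have next : ∀ k, HasTopForm (dickson 1 b (4 * k + 4)) (4 * k + 4) 0 0 0 →
      HasTopForm (dickson 1 b (4 * k + 5)) (4 * k + 5) b (b ^ 2) 0 →
      HasTopForm (dickson 1 b (4 * k + 6)) (4 * k + 6) 0 (b ^ 2) 0 ∧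
      HasTopForm (dickson 1 b (4 * k + 7)) (4 * k + 7) b 0 (b ^ 3) := by
    intro k h4 h5
    have h6 : HasTopForm (dickson 1 b (4 * k + 6)) (4 * k + 6) 0 (b ^ 2) 0 := by
      convert! h4.dickson_step h5 using 1 <;> ring
    refine ⟨h6, ?_⟩
    convert! h5.dickson_step h6 using 1
    · linear_combination b * two
    · ring
    · linear_combination b ^ 3 * two
  induction k with
  | zero =>
    have two' : (2 : F[X]) = 0 := CharTwo.two_eq_zero
    have h4 : HasTopForm (dickson 1 b 4) 4 0 0 0 := by
      have : dickson 1 b 4 = X ^ 4 := by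
        simp only [dickson]
        push_cast
        linear_combination (-2 * X ^ 2 * C b + C b ^ 2) * two'
      rw [HasTopForm, this]
      simp [← pow_add]
    have h5 : HasTopForm (dickson 1 b 5) 5 b (b ^ 2) 0 := by
      have : dickson 1 b 5 = X ^ 5 + C b * X ^ 3 + C b ^ 2 * X := by
        simp only [dickson]
        push_cast
        linear_combination (-3 * X ^ 3 * C b + 2 * X * C b ^ 2) * two'
      have e : X ^ 6 * dickson 1 b 5 - X ^ 5 * (X ^ 6 + C b * X ^ 4 + C (b ^ 2) * X ^ 2 + C 0)
          = 0 := by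
        rw [this, C_0, C_pow]
        ring
      rw [HasTopForm, e]
      exact Submodule.zero_mem _
    exact ⟨h4, h5, next 0 h4 h5⟩
  | succ k ih =>
    obtain ⟨-, -, h6, h7⟩ := ih
    have h8 : HasTopForm (dickson 1 b (4 * (k + 1) + 4)) (4 * (k + 1) + 4) 0 0 0 := by
      convert! h6.dickson_step h7 using 1 <;> ring
    have h9 : HasTopForm (dickson 1 b (4 * (k + 1) + 5)) (4 * (k + 1) + 5) b (b ^ 2) 0 := by
      convert! h7.dickson_step h8 using 1
      · linear_combination b * two
      · linear_combination b ^ 2 * two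
      · ring
    exact ⟨h8, h9, next _ h8 h9⟩

theorem natDegree_dickson_of_four_le (b : F) {s : ℕ} (hs : 4 ≤ s) :
    (dickson 1 b s).natDegree = s := by
  obtain ⟨k, hk⟩ : ∃ k, s = 4 * k + 4 ∨ s = 4 * k + 5 ∨ s = 4 * k + 6 ∨ s = 4 * k + 7 :=
    ⟨s / 4 - 1, by omega⟩
  obtain ⟨h4, h5, h6, h7⟩ := dickson_hasTopForm_four_mul b k
  rcases hk with rfl | rfl | rfl | rfl
  exacts [h4.natDegree_eq, h5.natDegree_eq, h6.natDegree_eq, h7.natDegree_eq]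

theorem HasTopForm.pow_four_mul {p : F[X]} {N : ℕ} {A B D : F} (h : HasTopForm p N A B D)
    (k : ℕ) : HasTopForm (p ^ (4 * k)) (N * (4 * k)) 0 0 0 := by
  have two : (2 : F) = 0 := CharTwo.two_eq_zero
  induction k with
  | zero => simpa using HasTopForm.one (F := F)
  | succ k ih =>
    have h2 : HasTopForm (p * p) (N + N) 0 (A * A) 0 := by
      convert! h.mul h using 1
      · linear_combination -A * two
      · linear_combination -B * two
      · linear_combination (-D - A * B) * two
    convert! ih.mul (h2.mul h2) using 1
    · ring
    · ring
    · ring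
    · linear_combination -A ^ 2 * two
    · ring

theorem dickson_pow_hasTopForm (b : F) {s d : ℕ} (hs : 5 ≤ s) :
    (s * d % 4 = 1 → HasTopForm (dickson 1 b s ^ d) (s * d) b (b ^ 2) 0) ∧
    (s * d % 4 = 3 → HasTopForm (dickson 1 b s ^ d) (s * d) b 0 (b ^ 3)) := by
  have two : (2 : F) = 0 := CharTwo.two_eq_zero
  obtain ⟨k, hk⟩ : ∃ k, s = 4 * k + 4 ∨ s = 4 * k + 5 ∨ s = 4 * k + 6 ∨ s = 4 * k + 7 :=
    ⟨s / 4 - 1, by omega⟩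
  obtain ⟨j, hj⟩ : ∃ j, d = 4 * j ∨ d = 4 * j + 1 ∨ d = 4 * j + 2 ∨ d = 4 * j + 3 :=
    ⟨d / 4, by omega⟩
  obtain ⟨-, h5, -, h7⟩ := dickson_hasTopForm_four_mul b k
  have mod : s * d % 4 = (s % 4) * (d % 4) % 4 := Nat.mul_mod _ _ _
  have pow1 : ∀ {N : ℕ} {p : F[X]} {A B D : F}, HasTopForm p N A B D →
      HasTopForm (p ^ (4 * j + 1)) (N * (4 * j + 1)) A B D := by
    intro N p A B D h
    convert! (h.pow_four_mul j).mul h using 1 <;> ring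
  have pow3 : ∀ {N : ℕ} {p : F[X]} {A B D : F}, HasTopForm p N A B D →
      HasTopForm (p ^ (4 * j + 3)) (N * (4 * j + 3)) A (B + A ^ 2) (D + A ^ 3) := by
    intro N p A B D h
    convert! ((pow1 h).mul h).mul h using 1
    · linear_combination -A * two
    · linear_combination (-B - A ^ 2) * two
    · linear_combination (-D - 3 * A * B) * two
  rcases hk with hk | hk | hk | hk
  · rw [show s % 4 = 0 by omega, zero_mul] at mod
    constructor <;> intro h <;> omega
  · rw [show s % 4 = 1 by omega, one_mul] at mod
    rw [← hk] at h5
    constructor <;> intro h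
    · rw [show d = 4 * j + 1 by omega]
      exact pow1 h5
    · rw [show d = 4 * j + 3 by omega]
      convert! pow3 h5 using 1
      · linear_combination -b ^ 2 * two
      · ring
  · rw [show s % 4 = 2 by omega] at mod
    constructor <;> intro h <;> omega
  · rw [show s % 4 = 3 by omega] at mod
    rw [← hk] at h7
    constructor <;> intro h
    · rw [show d = 4 * j + 3 by omega]
      convert! pow3 h7 using 1
      · ring
      · linear_combination -b ^ 3 * two
    · rw [show d = 4 * j + 1 by omega]
      exact pow1 h7

theorem coeff_sq_of_odd (p : F[X]) {i : ℕ} (hi : Odd i) : (p ^ 2).coeff i = 0 := by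
  rw [← map_frobenius_expand 2, coeff_map, coeff_expand two_pos,
    if_neg (by rwa [← even_iff_two_dvd, Nat.not_even_iff_odd]), map_zero]

theorem coeff_comp_of_odd {v p : F[X]} {i : ℕ} (hi : Odd i) (hv : Odd v.natDegree)
    (hdeg : v.natDegree * p.natDegree < i + 2 * p.natDegree) :
    (v.comp p).coeff i = v.leadingCoeff * (p ^ v.natDegree).coeff i := by
  rw [comp, eval₂_eq_sum_range, finsetSum_coeff, Finset.sum_range_succ, coeff_C_mul,
    Finset.sum_eq_zero, zero_add, leadingCoeff]
  intro e he
  rw [Finset.mem_range] at he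
  rw [coeff_C_mul]
  obtain ⟨r, hr⟩ := hv
  rcases Nat.lt_succ_iff_lt_or_eq.1 (Nat.lt_succ_of_le (Nat.le_sub_one_of_lt he)) with h | h
  · refine mul_eq_zero_of_right _ (coeff_eq_zero_of_natDegree_lt ?_)
    refine natDegree_pow_le.trans_lt ?_
    have : (e + 2) * p.natDegree ≤ v.natDegree * p.natDegree :=
      Nat.mul_le_mul_right _ (by omega)
    linarith
  · rw [show e = r * 2 by omega, pow_mul, coeff_sq_of_odd _ hi, mul_zero]

theorem coeff_taylor_eq_sum {R : Type*} [CommRing R] {h : R[X]} {l j : ℕ}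
    (hd : h.natDegree = l + j) (r : R) :
    (taylor r h).coeff l =
      ∑ i ∈ Finset.range (j + 1), ((l + i).choose i : R) * h.coeff (l + i) * r ^ i := by
  have hlt : (hasseDeriv l h).natDegree < j + 1 := by
    have := natDegree_hasseDeriv_le h l
    omega
  rw [taylor_coeff, eval_eq_sum_range' hlt]
  refine Finset.sum_congr rfl fun i _ => ?_
  rw [hasseDeriv_coeff, add_comm i l, Nat.choose_symm_add]

theorem X_mul_div_X_of_comp_X_sq (h : F[X]) (a : F) :
    X * (((h.comp (X ^ 2)).comp (X + C a) + C ((h.comp (X ^ 2)).eval a)) / X) =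
      expand F 2 (taylor (a ^ 2) h + C (h.eval (a ^ 2))) := by
  have e : (h.comp (X ^ 2)).comp (X + C a) + C ((h.comp (X ^ 2)).eval a) =
      expand F 2 (taylor (a ^ 2) h + C (h.eval (a ^ 2))) := by
    rw [expand_eq_comp_X_pow, taylor_apply, add_comp, comp_assoc, comp_assoc, C_comp, eval_comp]
    congr 2
    · simp [CharTwo.add_sq]
    · simp
  rw [e, EuclideanDomain.mul_div_cancel' X_ne_zero]
  rw [X_dvd_iff, coeff_zero_eq_eval_zero, expand_eval, eval_add, taylor_eval, eval_C]
  simp [CharTwo.add_self_eq_zero]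

theorem coeff_taylor_of_div_X_eq_comp_dickson {h v : F[X]} {a b : F} {s l : ℕ}
    (hd : h.natDegree = l + 3) (hs : 5 ≤ s)
    (heq : ((h.comp (X ^ 2)).comp (X + C a) + C ((h.comp (X ^ 2)).eval a)) / X =
      v.comp (dickson 1 b s)) :
    (taylor (a ^ 2) h).coeff (l + 2) = h.leadingCoeff * b ∧
    (taylor (a ^ 2) h).coeff (l + 1) = h.leadingCoeff * (if Even l then b ^ 2 else 0) ∧
    (0 < l → (taylor (a ^ 2) h).coeff l = h.leadingCoeff * (if Even l then 0 else b ^ 3)) := by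
  have key := X_mul_div_X_of_comp_X_sq h a
  rw [heq] at key
  have hcoeff : ∀ i, (v.comp (dickson 1 b s)).coeff (2 * i + 1) =
      (taylor (a ^ 2) h).coeff (i + 1) := by
    intro i
    rw [← coeff_X_mul, key, show 2 * i + 1 + 1 = (i + 1) * 2 by ring, coeff_expand_mul two_pos,
      coeff_add, coeff_C_succ, add_zero]
  have hD := natDegree_dickson_of_four_le b (show 4 ≤ s by omega)
  have hdeg : s * v.natDegree = 2 * l + 5 := by
    have h1 : (X * v.comp (dickson 1 b s)).natDegree = (l + 3) * 2 := by
      rw [key, natDegree_expand, natDegree_add_C, natDegree_taylor, hd]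
    by_cases h0 : v.comp (dickson 1 b s) = 0
    · rw [h0] at h1
      simp at h1
    · rw [natDegree_X_mul h0, natDegree_comp, hD, mul_comm] at h1
      omega
  have hv : Odd v.natDegree := by
    have : Odd (s * v.natDegree) := ⟨l + 2, by omega⟩
    exact (Nat.odd_mul.1 this).2
  have hlead : (taylor (a ^ 2) h).coeff (l + 3) = h.leadingCoeff := by
    rw [← hd, ← leadingCoeff_taylor (a ^ 2) h, leadingCoeff, natDegree_taylor]
  have hcomp : ∀ i, l ≤ i + 1 → (taylor (a ^ 2) h).coeff (i + 1) =
      v.leadingCoeff * (dickson 1 b s ^ v.natDegree).coeff (2 * i + 1) := by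
    intro i hi
    rw [← hcoeff, coeff_comp_of_odd ⟨i, rfl⟩ hv]
    rw [hD, mul_comm, hdeg]
    omega
  obtain ⟨hf1, hf3⟩ := dickson_pow_hasTopForm b (d := v.natDegree) hs
  rw [hdeg] at hf1 hf3
  have concl : ∀ {B D : F}, HasTopForm (dickson 1 b s ^ v.natDegree) (2 * l + 5) b B D →
      (taylor (a ^ 2) h).coeff (l + 2) = h.leadingCoeff * b ∧
      (taylor (a ^ 2) h).coeff (l + 1) = h.leadingCoeff * B ∧
      (0 < l → (taylor (a ^ 2) h).coeff l = h.leadingCoeff * D) := by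
    intro B D hf
    have hc : h.leadingCoeff = v.leadingCoeff := by
      rw [← hlead, hcomp (l + 2) (by omega), hf.coeff (j := 6) (by omega)]
      simp [coeff_X_pow]
    refine ⟨?_, ?_, fun hl => ?_⟩
    · rw [hcomp (l + 1) (by omega), hc, hf.coeff (j := 4) (by omega)]
      simp [coeff_X_pow]
    · rw [hcomp l (by omega), hc, hf.coeff (j := 2) (by omega)]
      simp [coeff_X_pow]
    · obtain ⟨i, rfl⟩ : ∃ i, l = i + 1 := ⟨l - 1, by omega⟩
      rw [hcomp i (by omega), hc, hf.coeff (j := 0) (by omega)]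
      simp [coeff_X_pow]
  by_cases hl : Even l
  · simp only [hl, if_true]
    obtain ⟨r, rfl⟩ := hl
    exact concl (hf1 (by omega))
  · simp only [hl, if_false]
    rw [Nat.not_even_iff_odd] at hl
    obtain ⟨r, rfl⟩ := hl
    exact concl (hf3 (by omega))

theorem natCast_eq_zero_of_even {n : ℕ} (hn : Even n) : (n : F) = 0 :=
  (CharP.cast_eq_zero_iff F 2 n).2 hn.two_dvd

theorem natCast_eq_one_of_odd {n : ℕ} (hn : Odd n) : (n : F) = 1 := by
  obtain ⟨r, rfl⟩ := hn
  push_cast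
  rw [CharTwo.two_eq_zero, zero_mul, zero_add]

theorem ncard_le_three_of_cubic_sq {S : Set F} {P : Cubic F} (hP : P.toPoly ≠ 0)
    (h : ∀ x ∈ S, P.a * (x ^ 2) ^ 3 + P.b * (x ^ 2) ^ 2 + P.c * x ^ 2 + P.d = 0) :
    S.ncard ≤ 3 := by
  classical
  have hle : S.ncard ≤ (P.roots.toFinset : Set F).ncard := by
    refine Set.ncard_le_ncard_of_injOn (fun x => x ^ 2) (fun x hx => ?_) ?_
      (Finset.finite_toSet _)
    · rw [Finset.mem_coe, Multiset.mem_toFinset, Cubic.mem_roots_iff hP]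
      exact h x hx
    · intro x _ y _ hxy
      exact CharTwo.sq_injective hxy
  rw [Set.ncard_coe_finset] at hle
  exact hle.trans Cubic.card_roots_le

end CharTwo

theorem odd_choose_two {k : ℕ} : Odd ((4 * k + 3).choose 2) := by
  rw [Nat.choose_two_right, show (4 * k + 3) * (4 * k + 3 - 1) = 2 * ((4 * k + 3) * (2 * k + 1)) by
    rw [show 4 * k + 3 - 1 = 4 * k + 2 by omega]; ring, Nat.mul_div_cancel_left _ two_pos]
  exact Odd.mul ⟨2 * k + 1, by ring⟩ ⟨k, rfl⟩

theorem odd_choose_three {k : ℕ} : Odd ((4 * k + 3).choose 3) := by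
  have h := Nat.choose_succ_right_eq (4 * k + 3) 2
  have : Odd ((4 * k + 3).choose 3 * (2 + 1)) := by
    rw [h]
    exact odd_choose_two.mul ⟨2 * k, by omega⟩
  exact (Nat.odd_mul.1 this).1

theorem even_choose_two {k : ℕ} : Even ((4 * k + 1).choose 2) := by
  rw [Nat.choose_two_right, show (4 * k + 1) * (4 * k + 1 - 1) = 2 * ((4 * k + 1) * (2 * k)) by
    rw [show 4 * k + 1 - 1 = 4 * k by omega]; ring, Nat.mul_div_cancel_left _ two_pos]
  exact (even_two_mul k).mul_left _

theorem statement19 (F : Type) [Field F] [Fintype F] (k : ℕ) (hk : 0 < k)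
    (hcard : Fintype.card F = 2 ^ k) (f : Polynomial F) (n : ℕ)
    (hdeg : f.natDegree = n) (hn : 6 ≤ n)
    (hsq : ∃ h : Polynomial F, f = h.comp (Polynomial.X ^ 2)) :
    3 < {a : F | ∃ (v : Polynomial F) (s : ℕ) (b : F), 5 ≤ s ∧ b ≠ 0 ∧
        (f.comp (Polynomial.X + Polynomial.C a) + Polynomial.C (f.eval a)) /
            Polynomial.X = v.comp (Polynomial.dickson 1 b s)}.ncard →
    ∃ ρ η : Polynomial F, ρ.degree = 1 ∧ η.degree = 1 ∧
      f = ρ.comp ((Polynomial.X ^ 6).comp η) := by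
  have : CharP F 2 := charP_of_card_eq_prime_pow hcard
  have two : (2 : F) = 0 := CharTwo.two_eq_zero
  obtain ⟨h, rfl⟩ := hsq
  obtain ⟨l, hl⟩ : ∃ l, h.natDegree = l + 3 := by
    rw [natDegree_comp, natDegree_X_pow] at hdeg
    exact ⟨h.natDegree - 3, by omega⟩
  set S : Set F := {a : F | ∃ (v : F[X]) (s : ℕ) (b : F), 5 ≤ s ∧ b ≠ 0 ∧
    ((h.comp (X ^ 2)).comp (X + C a) + C ((h.comp (X ^ 2)).eval a)) / X =
      v.comp (dickson 1 b s)}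
  intro hcardS
  have hc : h.leadingCoeff ≠ 0 := by
    rw [Ne, leadingCoeff_eq_zero]
    rintro rfl
    simp at hl
  set c := h.leadingCoeff with hcdef
  have hc' : h.coeff (l + 3) = c := by rw [hcdef, leadingCoeff, hl]
  have main : ∀ a ∈ S, ∃ b : F, b ≠ 0 ∧
      h.coeff (l + 2) + ((l + 3 : ℕ) : F) * c * a ^ 2 = c * b ∧
      h.coeff (l + 1) + ((l + 2 : ℕ) : F) * h.coeff (l + 2) * a ^ 2 +
        ((l + 3).choose 2 : F) * c * (a ^ 2) ^ 2 = c * (if Even l then b ^ 2 else 0) ∧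
      (0 < l → h.coeff l + ((l + 1 : ℕ) : F) * h.coeff (l + 1) * a ^ 2 +
        ((l + 2).choose 2 : F) * h.coeff (l + 2) * (a ^ 2) ^ 2 +
        ((l + 3).choose 3 : F) * c * (a ^ 2) ^ 3 = c * (if Even l then 0 else b ^ 3)) := by
    rintro a ⟨v, s, b, hs, hb, heq⟩
    obtain ⟨h1, h2, h3⟩ := coeff_taylor_of_div_X_eq_comp_dickson hl hs heq
    refine ⟨b, hb, ?_, ?_, fun h0 => ?_⟩
    · rw [← h1, coeff_taylor_eq_sum (j := 1) (by omega), ← hc']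
      simp only [Finset.sum_range_succ, Finset.sum_range_zero, Nat.choose_zero_right,
        Nat.choose_one_right]
      push_cast
      ring
    · rw [← h2, coeff_taylor_eq_sum (j := 2) (by omega), ← hc']
      simp only [Finset.sum_range_succ, Finset.sum_range_zero, Nat.choose_zero_right,
        Nat.choose_one_right]
      push_cast
      ring
    · rw [← h3 h0, coeff_taylor_eq_sum (j := 3) (by omega), ← hc']
      simp only [Finset.sum_range_succ, Finset.sum_range_zero, Nat.choose_zero_right,
        Nat.choose_one_right]
      push_cast
      ring_nf
  obtain ⟨r, hr⟩ : ∃ r, Odd l ∨ l = 4 * r + 2 ∨ l = 4 * r + 4 ∨ l = 0 := by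
    rcases Nat.even_or_odd l with h | h
    · have := Nat.even_iff.1 h
      exact ⟨(l - 1) / 4, by omega⟩
    · exact ⟨0, Or.inl h⟩
  have hne : S.Nonempty := Set.nonempty_of_ncard_ne_zero (by omega)
  rcases hr with hr | hr | hr | hr
  · exfalso
    have hr' : ¬ Even l := Nat.not_even_iff_odd.2 hr
    have e3 : ((l + 3 : ℕ) : F) = 0 := natCast_eq_zero_of_even (by grind)
    have e2 : ((l + 2 : ℕ) : F) = 1 := natCast_eq_one_of_odd (by grind)
    simp only [e3, e2, hr', if_false] at main
    have h1 : h.coeff (l + 2) ≠ 0 := by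
      obtain ⟨a, ha⟩ := hne
      obtain ⟨b, hb, h1, -⟩ := main a ha
      rw [show h.coeff (l + 2) = c * b by linear_combination h1]
      exact mul_ne_zero hc hb
    have := ncard_le_three_of_cubic_sq (S := S)
      (P := ⟨0, (l + 3).choose 2 * c, h.coeff (l + 2), h.coeff (l + 1)⟩)
      (Cubic.ne_zero_of_c_ne_zero h1) (fun a ha => by
        obtain ⟨b, hb, -, h2, -⟩ := main a ha
        linear_combination h2)
    omega
  · exfalso
    have hr' : Even l := by grind
    have e3 : ((l + 3 : ℕ) : F) = 1 := natCast_eq_one_of_odd (by grind)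
    have e2 : ((l + 2 : ℕ) : F) = 0 := natCast_eq_zero_of_even (by grind)
    have e4 : ((l + 3).choose 2 : F) = 0 := by
      rw [show l + 3 = 4 * (r + 1) + 1 by omega]
      exact natCast_eq_zero_of_even even_choose_two
    simp only [e3, e2, e4, hr', if_true] at main
    have := ncard_le_three_of_cubic_sq (S := S)
      (P := ⟨0, c ^ 2, 0, h.coeff (l + 2) ^ 2 - c * h.coeff (l + 1)⟩)
      (Cubic.ne_zero_of_b_ne_zero (pow_ne_zero 2 hc)) (fun a ha => by
        obtain ⟨b, hb, h1, h2, -⟩ := main a ha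
        linear_combination (h.coeff (l + 2) + c * a ^ 2 + c * b) * h1 - c * h2 -
          c * a ^ 2 * h.coeff (l + 2) * two)
    omega
  · exfalso
    have hr' : Even l := by grind
    have e1 : ((l + 1 : ℕ) : F) = 1 := natCast_eq_one_of_odd (by grind)
    have e4 : ((l + 3).choose 3 : F) = 1 := by
      rw [show l + 3 = 4 * (r + 1) + 3 by omega]
      exact natCast_eq_one_of_odd odd_choose_three
    simp only [e1, e4, hr', if_true] at main
    have := ncard_le_three_of_cubic_sq (S := S)
      (P := ⟨c, (l + 2).choose 2 * h.coeff (l + 2), h.coeff (l + 1), h.coeff l⟩)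
      (Cubic.ne_zero_of_a_ne_zero hc) (fun a ha => by
        obtain ⟨b, hb, -, -, h3⟩ := main a ha
        linear_combination h3 (by omega))
    omega
  · subst hr
    obtain ⟨a, ha⟩ := hne
    obtain ⟨b, -, h1, h2, -⟩ := main a ha
    simp only [zero_add, Nat.choose_succ_self_right, Even.zero, if_true] at h1 h2 hl hc'
    push_cast at h1 h2
    obtain ⟨g, hg⟩ : ∃ g, g ^ 2 = h.coeff 2 / c := by
      have : Function.Surjective (fun x : F => x ^ 2) :=
        Finite.surjective_of_injective CharTwo.sq_injective
      exact this _
    have hg2 : h.coeff 2 = c * g ^ 2 := by rw [hg]; field_simp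
    have hg1 : h.coeff 1 = c * g ^ 4 := by
      rw [hg2] at h1 h2
      have hb : b = g ^ 2 + 3 * a ^ 2 := mul_left_cancel₀ hc (by linear_combination -h1)
      rw [hb] at h2
      linear_combination h2 + (c * g ^ 2 * a ^ 2 * 2 + 3 * c * a ^ 4) * two
    refine ⟨C c * X + C (h.coeff 0 - c * g ^ 6), X + C g, degree_linear hc, degree_X_add_C g, ?_⟩
    have two' : (2 : F[X]) = 0 := CharTwo.two_eq_zero
    conv_lhs => rw [h.as_sum_range, hl]
    simp only [Finset.sum_range_succ, Finset.sum_range_zero, ← C_mul_X_pow_eq_monomial, hg2, hg1,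
      hc']
    simp only [add_comp, sub_comp, mul_comp, pow_comp, C_comp, X_comp, zero_comp, map_sub,
      map_mul, map_pow]
    linear_combination -C c * (3 * X ^ 5 * C g + 7 * X ^ 4 * C g ^ 2 + 10 * X ^ 3 * C g ^ 3 +
      7 * X ^ 2 * C g ^ 4 + 3 * X * C g ^ 5) * two'
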